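/- arXiv:math/0110167 — 8 statements merged into one kernel-verified Lean document; each statement's English description precedes it below -/
import Mathlib

section
/- Let T be a finite tree on a vertex set V with |V| ≥ 2, with an integer weight e(v) attached to each vertex, and let A be the associated intersection matrix: A_{vv} = e(v), A_{vw} = 1 if v and w are adjacent, and A_{vw} = 0 otherwise. Assume A is negative definite as a real quadratic form. If x ∈ ℤ^V is an integer vector such that the entry (A⁻¹x)_w is an integer for every leaf (degree-1 vertex) w of T, then (A⁻¹x)_v is an integer for every vertex v; equivalently, x lies in A·ℤ^V. -/
open Matrix

namespace SimpleGraph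

variable {V : Type*} {G : SimpleGraph V}

/-- In a rooted tree, the neighbor of a vertex that is closer to the root is unique. -/
theorem IsTree.eq_of_adj_of_dist_add_one (hG : G.IsTree) (r : V) {u w c : V}
    (hu : G.Adj u c) (hw : G.Adj w c) (hdu : G.dist r u + 1 = G.dist r c)
    (hdw : G.dist r w + 1 = G.dist r c) : u = w := by
  obtain ⟨p, hp⟩ := hG.connected.exists_walk_length_eq_dist r u
  obtain ⟨q, hq⟩ := hG.connected.exists_walk_length_eq_dist r w
  have hp' : (p.concat hu).IsPath :=
    Walk.isPath_of_length_eq_dist _ (by rw [Walk.length_concat, hp, hdu])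
  have hq' : (q.concat hw).IsPath :=
    Walk.isPath_of_length_eq_dist _ (by rw [Walk.length_concat, hq, hdw])
  exact (Walk.concat_inj ((hG.existsUnique_path r c).unique hp' hq')).1

/-- In a rooted tree, every vertex of degree at least two has a neighbor farther from the root. -/
theorem IsTree.exists_adj_dist_eq_add_one [Fintype V] [DecidableRel G.Adj] (hG : G.IsTree)
    (r : V) {v : V} (hv : 1 < G.degree v) : ∃ c, G.Adj v c ∧ G.dist r c = G.dist r v + 1 := by
  rw [← G.card_neighborFinset_eq_degree, Finset.one_lt_card] at hv
  obtain ⟨a, ha, b, hb, hab⟩ := hv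
  rw [mem_neighborFinset] at ha hb
  by_contra! h
  refine hab (hG.eq_of_adj_of_dist_add_one r ha.symm hb.symm ?_ ?_)
  · exact ((hG.dist_eq_dist_add_one_of_adj r ha).resolve_right (h a ha)).symm
  · exact ((hG.dist_eq_dist_add_one_of_adj r hb).resolve_right (h b hb)).symm

/-- A function on the vertices of a tree takes values in an additive subgroup `H` as soon as it
does so on the leaves, provided that at every vertex where its value lies in `H` the sum of its
values over the neighbors lies in `H` too. -/
theorem IsTree.forall_mem_of_forall_leaf_mem [Fintype V] [Nontrivial V] [DecidableRel G.Adj]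
    (hG : G.IsTree) {M : Type*} [AddCommGroup M] (H : AddSubgroup M) (y : V → M)
    (hleaf : ∀ w, G.degree w = 1 → y w ∈ H)
    (hsum : ∀ c, y c ∈ H → ∑ w ∈ G.neighborFinset c, y w ∈ H) (v : V) : y v ∈ H := by
  classical
  obtain ⟨r⟩ := hG.connected.nonempty
  obtain ⟨N, hN⟩ := (Set.finite_range (G.dist r)).bddAbove
  replace hN : ∀ u, G.dist r u ≤ N := fun u => hN ⟨u, rfl⟩
  induction hn : N - G.dist r v using Nat.strong_induction_on generalizing v with
  | _ n ih =>
    subst hn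
    have hfar (u : V) (hu : G.dist r v < G.dist r u) : y u ∈ H :=
      ih _ (by have := hN u; omega) u rfl
    have hpos := hG.connected.preconnected.degree_pos_of_nontrivial v
    by_cases hdeg : G.degree v = 1
    · exact hleaf v hdeg
    obtain ⟨c, hvc, hc⟩ := hG.exists_adj_dist_eq_add_one r (v := v) (by omega)
    have hmem : v ∈ G.neighborFinset c := by simpa using hvc.symm
    have hs := hsum c (hfar c (by omega))
    rw [← Finset.add_sum_erase _ _ hmem] at hs
    refine (H.add_mem_cancel_right (H.sum_mem fun u hu => hfar u ?_)).1 hs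
    rw [Finset.mem_erase, mem_neighborFinset] at hu
    rcases hG.dist_eq_dist_add_one_of_adj r hu.2 with h | h
    · exact absurd (hG.eq_of_adj_of_dist_add_one r hu.2.symm hvc h.symm hc.symm) hu.1
    · omega

end SimpleGraph

/-- A real square matrix whose quadratic form is negative definite is invertible. -/
theorem Matrix.isUnit_det_of_forall_dotProduct_mulVec_neg {n : Type*} [Fintype n] [DecidableEq n]
    {A : Matrix n n ℝ} (hA : ∀ y : n → ℝ, y ≠ 0 → y ⬝ᵥ A.mulVec y < 0) : IsUnit A.det := by
  rw [isUnit_iff_ne_zero]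
  intro h
  obtain ⟨y, hy, h0⟩ := Matrix.exists_mulVec_eq_zero_iff.2 h
  simpa [h0] using hA y hy

/-- Let `T` be a finite tree with at least two vertices, with an integer weight `e v` at each
vertex, and let `A` be the associated intersection matrix (`A v v = e v`, `A v w = 1` if `v,w`
adjacent, `0` otherwise), assumed negative definite as a real quadratic form.  If `x` is an
integer vector such that `(A⁻¹ x) w` is an integer for every leaf `w`, then `(A⁻¹ x) v` is an
integer for every vertex `v`; equivalently, `x` lies in `A · ℤ^V`. -/
theorem tree_intersection_matrix_leaf_integrality {V : Type*} [Fintype V] [DecidableEq V]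
    (G : SimpleGraph V) [DecidableRel G.Adj] (hconn : G.Connected) (hacyc : G.IsAcyclic)
    (hcard : 2 ≤ Fintype.card V) (e : V → ℤ)
    (A : Matrix V V ℝ)
    (hA : ∀ v w, A v w = if v = w then (e v : ℝ) else if G.Adj v w then 1 else 0)
    (hneg : ∀ y : V → ℝ, y ≠ 0 → y ⬝ᵥ A.mulVec y < 0)
    (x : V → ℤ)
    (hleaf : ∀ w, G.degree w = 1 → ∃ m : ℤ, A⁻¹.mulVec (fun v => (x v : ℝ)) w = m) :
    (∀ v, ∃ m : ℤ, A⁻¹.mulVec (fun u => (x u : ℝ)) v = m) ∧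
      (∃ y : V → ℤ, (fun v => (x v : ℝ)) = A.mulVec fun v => (y v : ℝ)) := by
  have hdet := Matrix.isUnit_det_of_forall_dotProduct_mulVec_neg hneg
  have : Nontrivial V := Fintype.one_lt_card_iff_nontrivial.1 hcard
  have hG : G.IsTree := ⟨hconn, hacyc⟩
  set y := A⁻¹.mulVec fun v => (x v : ℝ) with hy
  have hAy : A.mulVec y = fun v => (x v : ℝ) := by
    rw [hy, Matrix.mulVec_mulVec, Matrix.mul_nonsing_inv _ hdet, Matrix.one_mulVec]
  have hrow (c : V) : e c * y c + ∑ w ∈ G.neighborFinset c, y w = x c := by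
    rw [← congrFun hAy c, Matrix.mulVec, dotProduct,
      ← Finset.add_sum_erase _ _ (Finset.mem_univ c), hA, if_pos rfl]
    congr 1
    have hsub : G.neighborFinset c ⊆ Finset.univ.erase c := fun w hw =>
      Finset.mem_erase.2 ⟨((G.mem_neighborFinset c w).1 hw).ne', Finset.mem_univ w⟩
    rw [← Finset.sum_subset hsub]
    · refine Finset.sum_congr rfl fun w hw => ?_
      rw [SimpleGraph.mem_neighborFinset] at hw
      rw [hA, if_neg hw.ne, if_pos hw, one_mul]
    · intro w hw hcw
      rw [SimpleGraph.mem_neighborFinset] at hcw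
      rw [hA, if_neg (Finset.ne_of_mem_erase hw).symm, if_neg hcw, zero_mul]
  have hint : ∀ v, ∃ m : ℤ, y v = m := by
    have key := hG.forall_mem_of_forall_leaf_mem (Int.castAddHom ℝ).range y
      (fun w hw => (hleaf w hw).imp fun m hm => hm.symm) ?_
    · exact fun v => (key v).imp fun m hm => hm.symm
    · rintro c ⟨m, hm⟩
      refine ⟨x c - e c * m, ?_⟩
      replace hm : (m : ℝ) = y c := hm
      rw [Int.coe_castAddHom]
      push_cast
      rw [hm]
      linarith [hrow c]
  refine ⟨hint, ?_⟩
  choose z hz using hint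
  exact ⟨z, by rw [← hAy, funext hz]⟩
end

section
/- Let T be a finite tree on a vertex set V with |V| ≥ 2, with integer vertex weights, and let A be the associated intersection matrix (diagonal entries the weights, off-diagonal entries 1 for adjacent vertices and 0 otherwise), assumed negative definite. Then the cokernel ℤ^V/Aℤ^V (the discriminant group) is generated by the classes of the standard basis vectors e_w indexed by the leaves (degree-1 vertices) w of T. -/
open Matrix

/-- In a rooted tree, a vertex has at most one neighbour which is no farther from the root. -/
theorem SimpleGraph.IsTree.eq_of_adj_of_dist_le {V : Type*} {G : SimpleGraph V} (hG : G.IsTree)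
    {r v u u' : V} (hu : G.Adj u v) (hu' : G.Adj u' v) (hd : G.dist r u ≤ G.dist r v)
    (hd' : G.dist r u' ≤ G.dist r v) : u = u' := by
  classical
  have key : ∀ {x : V} (h : G.Adj x v), G.dist r x ≤ G.dist r v →
      ∃ q : G.Walk r x, (q.concat h).IsPath := by
    intro x h hx
    obtain ⟨q, hq, hlen⟩ := hG.connected.exists_path_of_dist r x
    refine ⟨q, (SimpleGraph.Walk.concat_isPath_iff h).2 ⟨hq, fun hv => ?_⟩⟩
    have h1 := SimpleGraph.Walk.length_takeUntil_lt_length hv h.ne'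
    have h2 := SimpleGraph.dist_le (q.takeUntil v hv)
    omega
  obtain ⟨q, hq⟩ := key hu hd
  obtain ⟨q', hq'⟩ := key hu' hd'
  have := congrArg SimpleGraph.Walk.penultimate ((hG.existsUnique_path r v).unique hq hq')
  simpa using this

/-- If a subgroup of `V → ℤ` contains a vector with value `1` at `v`, and the basis vectors at
all other vertices of its support, then it contains the basis vector at `v`. -/
theorem AddSubgroup.single_mem_of_apply_eq_one {V : Type*} [Fintype V] [DecidableEq V]
    (H : AddSubgroup (V → ℤ)) {p : V → ℤ} {v : V} (hp : p ∈ H) (hv : p v = 1)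
    (h : ∀ w, w ≠ v → p w ≠ 0 → Pi.single w (1 : ℤ) ∈ H) : Pi.single v (1 : ℤ) ∈ H := by
  have hsum : p = Pi.single v 1 + ∑ w ∈ Finset.univ.erase v, p w • Pi.single w (1 : ℤ) := by
    conv_lhs => rw [← Finset.univ_sum_single p, ← Finset.add_sum_erase _ _ (Finset.mem_univ v), hv]
    simp [← Pi.single_smul]
  have hrest : ∑ w ∈ Finset.univ.erase v, p w • Pi.single w (1 : ℤ) ∈ H := by
    refine H.sum_mem fun w hw => ?_
    by_cases h0 : p w = 0
    · simp [h0]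
    · exact H.zsmul_mem (h w (Finset.ne_of_mem_erase hw) h0) _
  rw [hsum] at hp
  exact (H.add_mem_cancel_right hrest).1 hp

/-- Let `T` be a finite tree with at least two vertices, with integer vertex weights, and let
`A` be the associated integer intersection matrix, assumed negative definite (as a real
quadratic form).  Then the cokernel `ℤ^V / A·ℤ^V` (the discriminant group) is generated by the
classes of the standard basis vectors `e_w` indexed by the leaves `w` of `T`; equivalently,
`ℤ^V` is generated as an abelian group by the image `A·ℤ^V` together with the basis vectors at
the leaves. -/
theorem tree_discriminant_group_generated_by_leaves {V : Type*} [Fintype V] [DecidableEq V]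
    (G : SimpleGraph V) [DecidableRel G.Adj] (hconn : G.Connected) (hacyc : G.IsAcyclic)
    (hcard : 2 ≤ Fintype.card V) (e : V → ℤ)
    (A : Matrix V V ℤ)
    (hA : ∀ v w, A v w = if v = w then e v else if G.Adj v w then 1 else 0)
    (hneg : ∀ y : V → ℝ, y ≠ 0 →
      y ⬝ᵥ (A.map (fun a => (a : ℝ))).mulVec y < 0) :
    AddSubgroup.closure
        ({p : V → ℤ | ∃ w, G.degree w = 1 ∧ p = Pi.single w 1} ∪
          {p : V → ℤ | ∃ y : V → ℤ, A.mulVec y = p}) = ⊤ := by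
  have hG : G.IsTree := ⟨hconn, hacyc⟩
  have : Nontrivial V := Fintype.one_lt_card_iff_nontrivial.1 hcard
  obtain ⟨r⟩ := hconn.nonempty
  set H := AddSubgroup.closure
    ({p : V → ℤ | ∃ w, G.degree w = 1 ∧ p = Pi.single w 1} ∪
      {p : V → ℤ | ∃ y : V → ℤ, A.mulVec y = p})
  have hcol : ∀ c, A.col c ∈ H := fun c =>
    AddSubgroup.subset_closure (Or.inr ⟨Pi.single c 1, by simp⟩)
  have hwf : WellFounded fun a b : V => G.dist r b < G.dist r a :=
    Finite.wellFounded_of_trans_of_irrefl (r := InvImage (· > ·) (G.dist r))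
  have hmem : ∀ v, Pi.single v (1 : ℤ) ∈ H := by
    intro v
    induction v using hwf.induction with
    | _ v ih =>
    by_cases hc : ∃ c, G.Adj c v ∧ G.dist r v < G.dist r c
    · obtain ⟨c, hcv, hlt⟩ := hc
      refine H.single_mem_of_apply_eq_one (hcol c) (by simp [hA, hcv.ne', hcv.symm]) ?_
      intro w hwv hw
      by_cases hwc : w = c
      · exact hwc ▸ ih c hlt
      have hadj : G.Adj w c := by
        by_contra hn
        simp [hA, hwc, hn] at hw
      refine ih w (lt_of_not_ge fun hle => hwv ?_)
      exact hG.eq_of_adj_of_dist_le hadj hcv.symm (hle.trans hlt.le) hlt.le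
    · push Not at hc
      refine AddSubgroup.subset_closure (Or.inl ⟨v, ?_, rfl⟩)
      rw [SimpleGraph.degree_eq_one_iff_existsUnique_adj]
      obtain ⟨u, hu⟩ := hconn.preconnected.exists_adj_of_nontrivial v
      exact ⟨u, hu, fun u' hu' =>
        hG.eq_of_adj_of_dist_le hu'.symm hu.symm (hc _ hu'.symm) (hc _ hu.symm)⟩
  refine (AddSubgroup.eq_top_iff' H).2 fun p => ?_
  rw [pi_eq_sum_univ' p]
  exact H.sum_mem fun w _ => H.zsmul_mem (hmem w) _
end

section
/- Let n ≥ 2 be an integer, let ζ = exp(2πi/n) ∈ ℂ, and let σ be the ℂ-algebra automorphism of the polynomial ring ℂ[x,y] determined by σ(x) = ζx, σ(y) = ζ⁻¹y (the action of the cyclic group C_n of order n on ℂ²). Then the fixed subalgebra ℂ[x,y]^{σ} is isomorphic as a ℂ-algebra to ℂ[z₁,z₂,z₃]/(z₁² + z₂² + z₃ⁿ), the coordinate ring of the Brieskorn variety V(2,2,n). Hence V(2,2,n) ≅ ℂ²/C_n. -/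
open MvPolynomial


/-- A diagonal substitution rescales the coefficient of `x^a y^b`. -/
theorem coeff_aeval_diagonal {R : Type*} [CommSemiring R] (a b : R) (m : Fin 2 →₀ ℕ)
    (p : MvPolynomial (Fin 2) R) :
    coeff m (aeval ![C a * X 0, C b * X 1] p) = a ^ m 0 * b ^ m 1 * coeff m p := by
  induction p using MvPolynomial.induction_on' with
  | monomial k r =>
    have hk : aeval ![C a * X 0, C b * X 1] (monomial k r)
        = monomial k (a ^ k 0 * b ^ k 1 * r) := by
      rw [aeval_monomial, Finsupp.prod_fintype _ _ (by simp), monomial_eq (s := k),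
        Finsupp.prod_fintype _ _ (by simp)]
      simp only [Fin.prod_univ_two, Matrix.cons_val_zero, Matrix.cons_val_one, algebraMap_eq,
        C_mul, C_pow]
      ring
    rw [hk, coeff_monomial, coeff_monomial]
    split_ifs with h
    · rw [h]
    · simp
  | add p q hp hq => rw [map_add, coeff_add, coeff_add, hp, hq, mul_add]

/-- A monomial occurring in a polynomial fixed by `x ↦ ζ x`, `y ↦ ζ⁻¹ y` has exponents congruent
modulo `n`. -/
theorem modEq_of_fixed {K : Type*} [Field K] {n : ℕ} {ζ : K} (hζ : IsPrimitiveRoot ζ n)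
    (hn : n ≠ 0) {p : MvPolynomial (Fin 2) K}
    (hp : aeval ![C ζ * X 0, C ζ⁻¹ * X 1] p = p) {m : Fin 2 →₀ ℕ} (hm : coeff m p ≠ 0) :
    m 0 ≡ m 1 [MOD n] := by
  have h := coeff_aeval_diagonal ζ ζ⁻¹ m p
  rw [hp] at h
  have h0 := hζ.ne_zero hn
  have h1 : ζ ^ m 0 * ζ⁻¹ ^ m 1 = 1 := mul_right_cancel₀ hm (by rw [← h, one_mul])
  rw [inv_pow, mul_inv_eq_one₀ (pow_ne_zero _ h0)] at h1
  rw [hζ.eq_orderOf]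
  exact (hζ.isOfFinOrder hn).pow_eq_pow_iff_modEq.1 h1

/-- A polynomial all of whose monomials have exponents congruent modulo `n` lies in any subalgebra
containing `x^n`, `y^n` and `xy`. -/
theorem mem_of_modEq {R : Type*} [CommSemiring R] {n : ℕ}
    {S : Subalgebra R (MvPolynomial (Fin 2) R)}
    (hx : X 0 ^ n ∈ S) (hy : X 1 ^ n ∈ S) (hxy : X 0 * X 1 ∈ S) {p : MvPolynomial (Fin 2) R}
    (hp : ∀ m, coeff m p ≠ 0 → m 0 ≡ m 1 [MOD n]) : p ∈ S := by
  rw [p.as_sum]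
  refine S.sum_mem fun m hm => ?_
  rw [monomial_eq, Finsupp.prod_fintype _ _ (by simp), Fin.prod_univ_two]
  refine S.mul_mem (S.algebraMap_mem _) ?_
  have h := hp m (mem_support_iff.1 hm)
  rcases le_total (m 0) (m 1) with hle | hle
  · obtain ⟨k, hk⟩ := (Nat.modEq_iff_dvd' hle).1 h
    rw [← Nat.add_sub_of_le hle, hk, pow_add, ← mul_assoc, ← mul_pow, pow_mul]
    exact S.mul_mem (S.pow_mem hxy _) (S.pow_mem hy _)
  · obtain ⟨k, hk⟩ := (Nat.modEq_iff_dvd' hle).1 h.symm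
    rw [← Nat.add_sub_of_le hle, hk, pow_add, mul_right_comm, ← mul_pow, pow_mul]
    exact S.mul_mem (S.pow_mem hxy _) (S.pow_mem hx _)

/-- An algebra generated by `u`, `v`, `w` with `u * v = w ^ n` embeds into the polynomial ring in
two variables as soon as it admits a homomorphism with `u ↦ x^n`, `v ↦ y^n`, `w ↦ xy`. -/
theorem injective_of_mul_eq_pow {R A : Type*} [CommRing R] [CommRing A] [Algebra R A] {n : ℕ}
    (hn : n ≠ 0) {u v w : A} (huv : u * v = w ^ n)
    (hsurj : Function.Surjective (aeval (R := R) ![u, v, w]))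
    (φ : A →ₐ[R] MvPolynomial (Fin 2) R) (hu : φ u = X 0 ^ n) (hv : φ v = X 1 ^ n)
    (hw : φ w = X 0 * X 1) : Function.Injective φ := by
  let ψ : MvPolynomial (Fin 2) R →ₗ[R] A := (basisMonomials (Fin 2) R).constr R fun m =>
    u ^ ((m 0 - m 1) / n) * v ^ ((m 1 - m 0) / n) * w ^ min (m 0) (m 1)
  have hψ (m : Fin 2 →₀ ℕ) : ψ (monomial m 1) =
      u ^ ((m 0 - m 1) / n) * v ^ ((m 1 - m 0) / n) * w ^ min (m 0) (m 1) := by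
    simpa only [coe_basisMonomials] using (basisMonomials (Fin 2) R).constr_basis R
      (fun m => u ^ ((m 0 - m 1) / n) * v ^ ((m 1 - m 0) / n) * w ^ min (m 0) (m 1)) m
  have hcomp : ψ ∘ₗ φ.toLinearMap ∘ₗ (aeval ![u, v, w]).toLinearMap
      = (aeval (R := R) ![u, v, w]).toLinearMap := by
    refine (basisMonomials (Fin 3) R).ext fun m => ?_
    have hm : (X 0 ^ n) ^ m 0 * (X 1 ^ n) ^ m 1 * (X 0 * X 1) ^ m 2 =
        monomial (R := R) (Finsupp.single (0 : Fin 2) (n * m 0 + m 2) +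
          Finsupp.single 1 (n * m 1 + m 2)) 1 := by
      rw [← one_mul (1 : R), ← monomial_mul, ← X_pow_eq_monomial, ← X_pow_eq_monomial]
      ring
    have hπ : aeval (R := R) ![u, v, w] (monomial m 1) = u ^ m 0 * v ^ m 1 * w ^ m 2 := by
      rw [aeval_monomial, Finsupp.prod_fintype _ _ (by simp), Fin.prod_univ_three]
      simp
    simp only [coe_basisMonomials, LinearMap.comp_apply, AlgHom.toLinearMap_apply, hπ, map_mul,
      map_pow, hu, hv, hw, hm, hψ]
    simp only [Finsupp.add_apply, Finsupp.single_apply, Fin.isValue, one_ne_zero, zero_ne_one,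
      if_true, if_false, add_zero, zero_add, Nat.add_sub_add_right, ← Nat.mul_sub,
      Nat.mul_div_cancel_left _ (Nat.pos_of_ne_zero hn)]
    rw [min_add_add_right, pow_add, Nat.mul_min_mul_left, pow_mul, ← huv, mul_pow]
    rcases le_total (m 0) (m 1) with hle | hle
    · obtain ⟨k, hk⟩ := Nat.exists_eq_add_of_le hle
      simp only [hk, Nat.sub_eq_zero_of_le (Nat.le_add_right _ k), Nat.add_sub_cancel_left,
        min_eq_left (Nat.le_add_right _ k)]
      ring
    · obtain ⟨k, hk⟩ := Nat.exists_eq_add_of_le hle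
      simp only [hk, Nat.sub_eq_zero_of_le (Nat.le_add_right _ k), Nat.add_sub_cancel_left,
        min_eq_right (Nat.le_add_right _ k)]
      ring
  refine Function.LeftInverse.injective (g := ψ) fun a => ?_
  obtain ⟨q, rfl⟩ := hsurj a
  exact LinearMap.congr_fun hcomp q




/-- Let `n ≥ 2`, `ζ = exp(2πi/n)`, and let `σ` be the ℂ-algebra endomorphism of `ℂ[x,y]`
with `σ(x) = ζ·x` and `σ(y) = ζ⁻¹·y` (the action of the cyclic group `C_n` on `ℂ²`).
Then the fixed subalgebra `ℂ[x,y]^σ` is isomorphic as a ℂ-algebra to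
`ℂ[z₁,z₂,z₃]/(z₁² + z₂² + z₃ⁿ)`, the coordinate ring of the Brieskorn variety `V(2,2,n)`.
Hence `V(2,2,n) ≅ ℂ²/C_n`. -/
theorem brieskorn_V22n_iso_C2_mod_Cn (n : ℕ) (hn : 2 ≤ n)
    (ζ : ℂ) (hζ : ζ = Complex.exp (2 * Real.pi * Complex.I / n))
    (σ : MvPolynomial (Fin 2) ℂ →ₐ[ℂ] MvPolynomial (Fin 2) ℂ)
    (hσ : σ = aeval ![C ζ * X 0, C ζ⁻¹ * X 1]) :
    Nonempty
      ((AlgHom.equalizer σ (AlgHom.id ℂ (MvPolynomial (Fin 2) ℂ))) ≃ₐ[ℂ]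
        (MvPolynomial (Fin 3) ℂ ⧸
          Ideal.span {(X 0 ^ 2 + X 1 ^ 2 + X 2 ^ n : MvPolynomial (Fin 3) ℂ)})) := by
  have hn0 : n ≠ 0 := by omega
  have hprim : IsPrimitiveRoot ζ n := hζ ▸ Complex.isPrimitiveRoot_exp n hn0
  have hI2 : (C Complex.I * C Complex.I : MvPolynomial (Fin 2) ℂ) = -1 := by
    rw [← C_mul, Complex.I_mul_I, C_neg, C_1]
  have hI3 : (C Complex.I * C Complex.I : MvPolynomial (Fin 3) ℂ) = -1 := by
    rw [← C_mul, Complex.I_mul_I, C_neg, C_1]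
  have hhalf2 : (C 2⁻¹ * 2 : MvPolynomial (Fin 2) ℂ) = 1 := by
    rw [← map_ofNat C 2, ← C_mul, inv_mul_cancel₀ two_ne_zero, C_1]
  have hhalf3 : (C 2⁻¹ * 2 : MvPolynomial (Fin 3) ℂ) = 1 := by
    rw [← map_ofNat C 2, ← C_mul, inv_mul_cancel₀ two_ne_zero, C_1]
  set f : MvPolynomial (Fin 3) ℂ := X 0 ^ 2 + X 1 ^ 2 + X 2 ^ n with hf
  let z : Fin 3 → MvPolynomial (Fin 2) ℂ :=
    ![C 2⁻¹ * (X 0 ^ n - X 1 ^ n), -(C Complex.I * C 2⁻¹ * (X 0 ^ n + X 1 ^ n)), X 0 * X 1]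
  have hzf : aeval z f = 0 := by
    simp only [hf, z, map_add, map_pow, aeval_X, Matrix.cons_val, mul_pow]
    linear_combination (C 2⁻¹) ^ 2 * (X 0 ^ n + X 1 ^ n) ^ 2 * hI2
      - (X 0 ^ n * X 1 ^ n) * (C 2⁻¹ * 2 + 1) * hhalf2
  let φ : (MvPolynomial (Fin 3) ℂ ⧸ Ideal.span {f}) →ₐ[ℂ] MvPolynomial (Fin 2) ℂ :=
    Ideal.Quotient.liftₐ (Ideal.span {f}) (aeval z) fun a ha => by
      obtain ⟨b, rfl⟩ := Ideal.mem_span_singleton.1 ha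
      rw [map_mul, hzf, zero_mul]
  let π := Ideal.Quotient.mkₐ ℂ (Ideal.span {f})
  have hφπ (q) : φ (π q) = aeval z q := rfl
  have hu : φ (π (X 0 + C Complex.I * X 1)) = X 0 ^ n := by
    simp only [hφπ, z, map_add, map_mul, aeval_X, aeval_C, algebraMap_eq, Matrix.cons_val]
    linear_combination -(C 2⁻¹ * (X 0 ^ n + X 1 ^ n)) * hI2 + X 0 ^ n * hhalf2
  have hv : φ (π (C Complex.I * X 1 - X 0)) = X 1 ^ n := by
    simp only [hφπ, z, map_sub, map_mul, aeval_X, aeval_C, algebraMap_eq, Matrix.cons_val]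
    linear_combination -(C 2⁻¹ * (X 0 ^ n + X 1 ^ n)) * hI2 + X 1 ^ n * hhalf2
  have hw : φ (π (X 2)) = X 0 * X 1 := by simp [hφπ, z]
  have huv : π (X 0 + C Complex.I * X 1) * π (C Complex.I * X 1 - X 0) = π (X 2) ^ n := by
    rw [← map_mul, ← map_pow]
    refine Ideal.Quotient.eq.2 (Ideal.mem_span_singleton.2 ⟨-1, ?_⟩)
    rw [hf]
    linear_combination X 1 ^ 2 * hI3
  have hsurj : Function.Surjective (aeval (R := ℂ)
      ![π (X 0 + C Complex.I * X 1), π (C Complex.I * X 1 - X 0), π (X 2)]) := by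
    let y : Fin 3 → MvPolynomial (Fin 3) ℂ :=
      ![C 2⁻¹ * (X 0 - X 1), -(C Complex.I * C 2⁻¹ * (X 0 + X 1)), X 2]
    have hcomp : (aeval (R := ℂ)
        ![π (X 0 + C Complex.I * X 1), π (C Complex.I * X 1 - X 0), π (X 2)]).comp (aeval y)
        = π := by
      have hC (c : ℂ) : algebraMap ℂ (MvPolynomial (Fin 3) ℂ ⧸ Ideal.span {f}) c = π (C c) := rfl
      ext i
      fin_cases i <;>
        simp only [y, AlgHom.comp_apply, aeval_X, aeval_C, Fin.zero_eta, Fin.mk_one,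
          Fin.reduceFinMk, Matrix.cons_val, map_mul, map_sub, map_add, map_neg, hC] <;>
        simp only [← map_mul π, ← map_sub π, ← map_add π, ← map_neg π]
      · congr 1
        linear_combination X 0 * hhalf3
      · congr 1
        linear_combination -(C 2⁻¹ * 2 * X 1) * hI3 + X 1 * hhalf3
    intro a
    obtain ⟨q, rfl⟩ := Ideal.Quotient.mkₐ_surjective ℂ (Ideal.span {f}) a
    exact ⟨aeval y q, DFunLike.congr_fun hcomp q⟩
  have hinj := injective_of_mul_eq_pow hn0 huv hsurj φ hu hv hw
  have hrange : φ.range = AlgHom.equalizer σ (AlgHom.id ℂ (MvPolynomial (Fin 2) ℂ)) := by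
    apply le_antisymm
    · rintro _ ⟨a, rfl⟩
      obtain ⟨q, rfl⟩ := Ideal.Quotient.mkₐ_surjective ℂ (Ideal.span {f}) a
      have hcomp : σ.comp (aeval z) = aeval z := by
        have h1 : (C ζ : MvPolynomial (Fin 2) ℂ) ^ n = 1 := by
          rw [← C_pow, hprim.pow_eq_one, C_1]
        have h2 : (C ζ⁻¹ : MvPolynomial (Fin 2) ℂ) ^ n = 1 := by
          rw [← C_pow, inv_pow, hprim.pow_eq_one, inv_one, C_1]
        have h3 : (C ζ * C ζ⁻¹ : MvPolynomial (Fin 2) ℂ) = 1 := by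
          rw [← C_mul, mul_inv_cancel₀ (hprim.ne_zero hn0), C_1]
        refine algHom_ext fun i => ?_
        fin_cases i <;>
          simp only [hσ, z, AlgHom.comp_apply, aeval_X, aeval_C, algebraMap_eq, Fin.zero_eta,
            Fin.mk_one, Fin.reduceFinMk, Matrix.cons_val, map_mul, map_sub, map_add, map_neg,
            map_pow, mul_pow, h1, h2, one_mul]
        linear_combination X 0 * X 1 * h3
      exact DFunLike.congr_fun hcomp q
    · intro p hp
      subst hσ
      exact mem_of_modEq (S := φ.range) ⟨_, hu⟩ ⟨_, hv⟩ ⟨_, hw⟩ fun m => modEq_of_fixed hprim hn0 hp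
  exact ⟨((AlgEquiv.ofInjective φ hinj).trans (Subalgebra.equivOfEq _ _ hrange)).symm⟩
end

section
/- Let Q₈ be the subgroup of GL₂(ℂ) generated by g₁ = [[i,0],[0,−i]] and g₂ = [[0,1],[−1,0]] (the quaternion group of order 8, i.e. the binary dihedral group Δ'(2,2,2)), acting on the polynomial ring ℂ[x,y] by linear substitution of the variables. Then the invariant subalgebra ℂ[x,y]^{Q₈} is isomorphic as a ℂ-algebra to ℂ[z₁,z₂,z₃]/(z₁² + z₂³ + z₃³), the coordinate ring of the Brieskorn variety V(2,3,3). Hence V(2,3,3) ≅ ℂ²/Δ'(2,2,2). -/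
open MvPolynomial

/-- The ℂ-algebra endomorphism of `ℂ[x,y]` given by the linear substitution of variables by an
invertible 2×2 matrix `M`: `x_i ↦ Σ_j M i j · x_j`. -/
noncomputable def linSubst (M : Matrix (Fin 2) (Fin 2) ℂ) :
    MvPolynomial (Fin 2) ℂ →ₐ[ℂ] MvPolynomial (Fin 2) ℂ :=
  aeval fun i => ∑ j, C (M i j) * X j

/-- The subalgebra of `ℂ[x,y]` of polynomials invariant under linear substitution by all
matrices in a subgroup `G` of `GL₂(ℂ)`. -/
noncomputable def invariantSubalgebra (G : Subgroup (Matrix (Fin 2) (Fin 2) ℂ)ˣ) :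
    Subalgebra ℂ (MvPolynomial (Fin 2) ℂ) :=
  ⨅ u ∈ G, AlgHom.equalizer (linSubst (u : Matrix (Fin 2) (Fin 2) ℂ))
    (AlgHom.id ℂ (MvPolynomial (Fin 2) ℂ))

theorem linSubst_X (M : Matrix (Fin 2) (Fin 2) ℂ) (i : Fin 2) :
    linSubst M (X i) = C (M i 0) * X 0 + C (M i 1) * X 1 := by
  simp [linSubst, Fin.sum_univ_two]

theorem linSubst_mul (M N : Matrix (Fin 2) (Fin 2) ℂ) (p : MvPolynomial (Fin 2) ℂ) :
    linSubst (M * N) p = linSubst N (linSubst M p) := by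
  suffices h : linSubst (M * N) = (linSubst N).comp (linSubst M) from DFunLike.congr_fun h p
  ext1 i
  have hC (r : ℂ) : linSubst N (C r) = C r := (linSubst N).commutes r
  simp only [AlgHom.comp_apply, linSubst_X, map_add, map_mul, hC, Matrix.mul_apply,
    Fin.sum_univ_two]
  ring

theorem linSubst_one (p : MvPolynomial (Fin 2) ℂ) : linSubst 1 p = p := by
  suffices h : linSubst 1 = AlgHom.id ℂ _ from DFunLike.congr_fun h p
  ext1 i
  fin_cases i <;> simp [linSubst_X]

theorem mem_invariantSubalgebra {G : Subgroup (Matrix (Fin 2) (Fin 2) ℂ)ˣ}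
    {p : MvPolynomial (Fin 2) ℂ} :
    p ∈ invariantSubalgebra G ↔
      ∀ u ∈ G, linSubst (u : Matrix (Fin 2) (Fin 2) ℂ) p = p := by
  simp [invariantSubalgebra, Algebra.mem_iInf]

theorem mem_invariantSubalgebra_closure {S : Set (Matrix (Fin 2) (Fin 2) ℂ)ˣ}
    {p : MvPolynomial (Fin 2) ℂ} :
    p ∈ invariantSubalgebra (Subgroup.closure S) ↔
      ∀ u ∈ S, linSubst (u : Matrix (Fin 2) (Fin 2) ℂ) p = p := by
  rw [mem_invariantSubalgebra]
  refine ⟨fun h u hu => h u (Subgroup.subset_closure hu), fun h u hu => ?_⟩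
  induction hu using Subgroup.closure_induction with
  | mem u hu => exact h u hu
  | one => simpa using linSubst_one p
  | mul u v _ _ hu hv => rw [Units.val_mul, linSubst_mul, hu, hv]
  | inv u _ hu =>
    conv_lhs => rw [← hu]
    rw [← linSubst_mul, Units.mul_inv, linSubst_one]

/-- Invariance under the quaternion group only has to be tested on the two generators. -/
theorem mem_invariantSubalgebra_quaternion {p : MvPolynomial (Fin 2) ℂ} :
    p ∈ invariantSubalgebra (Subgroup.closure
      {u : (Matrix (Fin 2) (Fin 2) ℂ)ˣ |
        (u : Matrix (Fin 2) (Fin 2) ℂ) = !![Complex.I, 0; 0, -Complex.I] ∨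
        (u : Matrix (Fin 2) (Fin 2) ℂ) = !![0, 1; -1, 0]}) ↔
      linSubst !![Complex.I, 0; 0, -Complex.I] p = p ∧ linSubst !![0, 1; -1, 0] p = p := by
  rw [mem_invariantSubalgebra_closure]
  constructor
  · intro h
    have h₁ : IsUnit (!![Complex.I, 0; 0, -Complex.I] : Matrix (Fin 2) (Fin 2) ℂ) := by
      simp [Matrix.isUnit_iff_isUnit_det, Matrix.det_fin_two]
    have h₂ : IsUnit (!![0, 1; -1, 0] : Matrix (Fin 2) (Fin 2) ℂ) := by
      simp [Matrix.isUnit_iff_isUnit_det, Matrix.det_fin_two]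
    obtain ⟨u, hu⟩ := h₁
    obtain ⟨v, hv⟩ := h₂
    exact ⟨hu ▸ h u (Or.inl hu), hv ▸ h v (Or.inr hv)⟩
  · rintro ⟨h₁, h₂⟩ u (hu | hu)
    · rw [hu, h₁]
    · rw [hu, h₂]

theorem coeff_linSubst_diagonal (d e : ℂ) (p : MvPolynomial (Fin 2) ℂ) (s : Fin 2 →₀ ℕ) :
    coeff s (linSubst !![d, 0; 0, e] p) = d ^ s 0 * e ^ s 1 * coeff s p := by
  induction p using MvPolynomial.induction_on' with
  | monomial t r =>
    have h : linSubst !![d, 0; 0, e] (monomial t r) = C (d ^ t 0 * e ^ t 1) * monomial t r := by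
      have hC : linSubst !![d, 0; 0, e] (C r) = C r := (linSubst _).commutes r
      rw [monomial_fin_two, mul_assoc]
      simp only [map_mul, map_pow, hC, linSubst_X]
      simp
      ring
    rw [h, coeff_C_mul, coeff_monomial]
    split_ifs with hts
    · rw [hts]
    · simp
  | add p q hp hq => rw [map_add, coeff_add, hp, hq, coeff_add, mul_add]

theorem modEq_four_of_I_pow_mul {m n : ℕ} (h : Complex.I ^ m * (-Complex.I) ^ n = 1) :
    m ≡ n [MOD 4] := by
  have h3 : -Complex.I = Complex.I ^ 3 := Complex.I_pow_three.symm
  rw [h3, ← pow_mul, ← pow_add] at h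
  have hI : IsPrimitiveRoot Complex.I 4 := Complex.isPrimitiveRoot_I
  have := hI.dvd_of_pow_eq_one _ h
  unfold Nat.ModEq
  omega

section Fundamental

variable {R : Type*} [CommRing R] [Algebra ℂ R] {A : Subalgebra ℂ R} {x y : R}

theorem pow_four_add_pow_four_mem (ha : x ^ 2 * y ^ 2 ∈ A) (hb : x ^ 4 + y ^ 4 ∈ A) (k : ℕ) :
    x ^ (4 * k) + y ^ (4 * k) ∈ A := by
  induction k using Nat.twoStepInduction with
  | zero => simpa using A.add_mem A.one_mem A.one_mem
  | one => simpa using hb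
  | more k h₀ h₁ =>
    convert A.sub_mem (A.mul_mem hb h₁) (A.mul_mem (A.pow_mem ha 2) h₀) using 1
    ring

theorem mul_pow_four_sub_pow_four_mem (ha : x ^ 2 * y ^ 2 ∈ A) (hb : x ^ 4 + y ^ 4 ∈ A)
    (hc : x * y * (x ^ 4 - y ^ 4) ∈ A) (k : ℕ) :
    x * y * (x ^ (4 * k) - y ^ (4 * k)) ∈ A := by
  induction k using Nat.twoStepInduction with
  | zero => simp
  | one => simpa using hc
  | more k h₀ h₁ =>
    convert A.sub_mem (A.mul_mem hb h₁) (A.mul_mem (A.pow_mem ha 2) h₀) using 1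
    ring

theorem symmetrized_monomial_mem_of_le (ha : x ^ 2 * y ^ 2 ∈ A) (hb : x ^ 4 + y ^ 4 ∈ A)
    (hc : x * y * (x ^ 4 - y ^ 4) ∈ A) (n k : ℕ) :
    x ^ (n + 4 * k) * y ^ n + (-1) ^ n * (x ^ n * y ^ (n + 4 * k)) ∈ A := by
  obtain ⟨l, rfl | rfl⟩ := Nat.even_or_odd' n
  · convert A.mul_mem (A.pow_mem ha l) (pow_four_add_pow_four_mem ha hb k) using 1
    rw [pow_mul (-1 : R), neg_one_sq, one_pow, mul_pow, ← pow_mul, ← pow_mul]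
    ring
  · convert A.mul_mem (A.pow_mem ha l) (mul_pow_four_sub_pow_four_mem ha hb hc k) using 1
    rw [pow_succ (-1 : R), pow_mul (-1 : R), neg_one_sq, one_pow, mul_pow, ← pow_mul, ← pow_mul]
    ring

theorem symmetrized_monomial_mem (ha : x ^ 2 * y ^ 2 ∈ A) (hb : x ^ 4 + y ^ 4 ∈ A)
    (hc : x * y * (x ^ 4 - y ^ 4) ∈ A) {m n : ℕ} (h : m ≡ n [MOD 4]) :
    x ^ m * y ^ n + (-1) ^ n * (x ^ n * y ^ m) ∈ A := by
  unfold Nat.ModEq at h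
  obtain hmn | hmn := le_total n m
  · obtain ⟨k, rfl⟩ : ∃ k, m = n + 4 * k := ⟨(m - n) / 4, by omega⟩
    exact symmetrized_monomial_mem_of_le ha hb hc n k
  · obtain ⟨k, rfl⟩ : ∃ k, n = m + 4 * k := ⟨(n - m) / 4, by omega⟩
    have hs : (-1 : R) ^ (m + 4 * k) = (-1) ^ m := by
      rw [pow_add, pow_mul, show (-1 : R) ^ 4 = 1 by norm_num, one_pow, mul_one]
    have hu : (-1 : R) ^ m * (-1) ^ m = 1 := by rw [← mul_pow]; simp
    have hmem : (-1 : R) ^ m ∈ A := A.pow_mem (A.neg_mem A.one_mem) m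
    convert A.mul_mem hmem (symmetrized_monomial_mem_of_le ha hb hc m k) using 1
    rw [hs]
    linear_combination (-(x ^ m * y ^ (m + 4 * k))) * hu

end Fundamental

theorem linSubst_quarterTurn_monomial (s : Fin 2 →₀ ℕ) (r : ℂ) :
    linSubst !![0, 1; -1, 0] (monomial s r) =
      C r * ((-1) ^ s 1 * (X 0 ^ s 1 * X 1 ^ s 0)) := by
  have hC : linSubst !![0, 1; -1, 0] (C r) = C r := (linSubst _).commutes r
  have h0 : linSubst !![0, 1; -1, 0] (X 0) = X 1 := by simp [linSubst_X]
  have h1 : linSubst !![0, 1; -1, 0] (X 1) = -X 0 := by simp [linSubst_X]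
  rw [monomial_fin_two, mul_assoc]
  simp only [map_mul, map_pow, hC, h0, h1]
  rw [neg_pow (X 0 : MvPolynomial (Fin 2) ℂ)]
  ring

/-- The polynomials `x²y²`, `x⁴ + y⁴` and `xy(x⁴ - y⁴)` generate the invariants of the
quaternion group. -/
theorem mem_of_quaternion_invariant {A : Subalgebra ℂ (MvPolynomial (Fin 2) ℂ)}
    (ha : X 0 ^ 2 * X 1 ^ 2 ∈ A) (hb : X 0 ^ 4 + X 1 ^ 4 ∈ A)
    (hc : X 0 * X 1 * (X 0 ^ 4 - X 1 ^ 4) ∈ A) {p : MvPolynomial (Fin 2) ℂ}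
    (h₁ : linSubst !![Complex.I, 0; 0, -Complex.I] p = p)
    (h₂ : linSubst !![0, 1; -1, 0] p = p) : p ∈ A := by
  have hsum : p + p = ∑ s ∈ p.support, (monomial s (coeff s p) +
      linSubst !![0, 1; -1, 0] (monomial s (coeff s p))) := by
    rw [Finset.sum_add_distrib, ← map_sum, ← p.as_sum, h₂]
  have hmem : p + p ∈ A := by
    rw [hsum]
    refine A.sum_mem fun s hs => ?_
    have hmod : s 0 ≡ s 1 [MOD 4] := by
      have h := coeff_linSubst_diagonal Complex.I (-Complex.I) p s
      rw [h₁] at h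
      exact modEq_four_of_I_pow_mul (mul_right_cancel₀ (mem_support_iff.mp hs)
        (by rw [one_mul]; exact h.symm))
    rw [linSubst_quarterTurn_monomial, monomial_fin_two, mul_assoc, ← mul_add]
    exact A.mul_mem (A.algebraMap_mem _) (symmetrized_monomial_mem ha hb hc hmod)
  have : p = (2⁻¹ : ℂ) • (p + p) := by
    rw [← two_smul ℂ p, smul_smul]; simp
  rw [this]
  exact A.smul_mem hmem _

/-- The parametrization of `V(2,3,3)` by `z₁ = xy(x⁴ - y⁴)` and `z₂, z₃ = αx²y² ± β(x⁴ + y⁴)`,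
valid when `α³ = 2` and `6αβ² = -1`. -/
noncomputable def brieskornParam (α β : ℂ) :
    MvPolynomial (Fin 3) ℂ →ₐ[ℂ] MvPolynomial (Fin 2) ℂ :=
  aeval ![X 0 * X 1 * (X 0 ^ 4 - X 1 ^ 4),
    C α * (X 0 ^ 2 * X 1 ^ 2) + C β * (X 0 ^ 4 + X 1 ^ 4),
    C α * (X 0 ^ 2 * X 1 ^ 2) - C β * (X 0 ^ 4 + X 1 ^ 4)]

section Param

variable {α β : ℂ}

theorem brieskornParam_X_zero :
    brieskornParam α β (X 0) = X 0 * X 1 * (X 0 ^ 4 - X 1 ^ 4) := by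
  simp [brieskornParam]

theorem brieskornParam_X_one :
    brieskornParam α β (X 1) = C α * (X 0 ^ 2 * X 1 ^ 2) + C β * (X 0 ^ 4 + X 1 ^ 4) := by
  simp [brieskornParam]

theorem brieskornParam_X_two :
    brieskornParam α β (X 2) = C α * (X 0 ^ 2 * X 1 ^ 2) - C β * (X 0 ^ 4 + X 1 ^ 4) := by
  simp [brieskornParam]

theorem brieskornParam_equation (hα : α ^ 3 = 2) (hβ : 6 * α * β ^ 2 = -1) :
    brieskornParam α β (X 0 ^ 2 + X 1 ^ 3 + X 2 ^ 3) = 0 := by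
  have hα' : (C α : MvPolynomial (Fin 2) ℂ) ^ 3 = 2 := by rw [← C_pow, hα]; rfl
  have hβ' : 6 * C α * (C β : MvPolynomial (Fin 2) ℂ) ^ 2 = -1 := by
    have := congrArg (C : ℂ →+* MvPolynomial (Fin 2) ℂ) hβ
    simp only [map_mul, map_pow, map_neg, map_one] at this
    exact this
  simp only [map_add, map_pow, brieskornParam_X_zero, brieskornParam_X_one, brieskornParam_X_two]
  linear_combination (2 * (X 0 ^ 2 * X 1 ^ 2) ^ 3) * hα' +
    (X 0 ^ 2 * X 1 ^ 2) * (X 0 ^ 4 + X 1 ^ 4) ^ 2 * hβ'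

theorem range_brieskornParam (hα : α ≠ 0) (hβ : β ≠ 0) :
    (brieskornParam α β).range = invariantSubalgebra (Subgroup.closure
      {u : (Matrix (Fin 2) (Fin 2) ℂ)ˣ |
        (u : Matrix (Fin 2) (Fin 2) ℂ) = !![Complex.I, 0; 0, -Complex.I] ∨
        (u : Matrix (Fin 2) (Fin 2) ℂ) = !![0, 1; -1, 0]}) := by
  have hCα : (C α : MvPolynomial (Fin 2) ℂ) * C α⁻¹ = 1 := by
    rw [← C_mul, mul_inv_cancel₀ hα, C_1]
  have hCβ : (C β : MvPolynomial (Fin 2) ℂ) * C β⁻¹ = 1 := by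
    rw [← C_mul, mul_inv_cancel₀ hβ, C_1]
  have hC2 : (2 : MvPolynomial (Fin 2) ℂ) * C 2⁻¹ = 1 := by
    rw [show (2 : MvPolynomial (Fin 2) ℂ) = C 2 from rfl, ← C_mul, mul_inv_cancel₀ two_ne_zero, C_1]
  have hC (r : ℂ) : brieskornParam α β (C r) = C r := (brieskornParam α β).commutes r
  apply le_antisymm
  · rintro _ ⟨q, rfl⟩
    rw [mem_invariantSubalgebra_quaternion]
    have hI : (C Complex.I : MvPolynomial (Fin 2) ℂ) ^ 2 = -1 := by
      rw [← C_pow, Complex.I_sq, C_neg, C_1]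
    have key (M : Matrix (Fin 2) (Fin 2) ℂ)
        (h : ∀ i, linSubst M (brieskornParam α β (X i)) = brieskornParam α β (X i)) :
        linSubst M (brieskornParam α β q) = brieskornParam α β q := by
      suffices h' : (linSubst M).comp (brieskornParam α β) = brieskornParam α β from
        DFunLike.congr_fun h' q
      exact MvPolynomial.algHom_ext h
    have hCM (M : Matrix (Fin 2) (Fin 2) ℂ) (r : ℂ) : linSubst M (C r) = C r :=
      (linSubst M).commutes r
    have hI4 : (C Complex.I : MvPolynomial (Fin 2) ℂ) ^ 4 = 1 := by
      linear_combination (C Complex.I ^ 2 - 1) * hI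
    constructor <;> refine key _ fun i => ?_
    · have h0 : linSubst !![Complex.I, 0; 0, -Complex.I] (X 0) = C Complex.I * X 0 := by
        simp [linSubst_X]
      have h1 : linSubst !![Complex.I, 0; 0, -Complex.I] (X 1) = -C Complex.I * X 1 := by
        simp [linSubst_X]
      fin_cases i <;>
        simp only [Fin.zero_eta, Fin.mk_one, Fin.reduceFinMk, brieskornParam_X_zero,
          brieskornParam_X_one, brieskornParam_X_two, map_add, map_sub, map_mul, map_pow, hCM,
          h0, h1]
      · linear_combination (-(X 0 * X 1 * (X 0 ^ 4 - X 1 ^ 4)) *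
          (C Complex.I ^ 4 - C Complex.I ^ 2 + 1)) * hI
      · linear_combination (C α * (X 0 ^ 2 * X 1 ^ 2) + C β * (X 0 ^ 4 + X 1 ^ 4)) * hI4
      · linear_combination (C α * (X 0 ^ 2 * X 1 ^ 2) - C β * (X 0 ^ 4 + X 1 ^ 4)) * hI4
    · have h0 : linSubst !![0, 1; -1, 0] (X 0) = X 1 := by simp [linSubst_X]
      have h1 : linSubst !![0, 1; -1, 0] (X 1) = -X 0 := by simp [linSubst_X]
      fin_cases i <;>
        simp only [Fin.zero_eta, Fin.mk_one, Fin.reduceFinMk, brieskornParam_X_zero,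
          brieskornParam_X_one, brieskornParam_X_two, map_add, map_sub, map_mul, map_pow, hCM,
          h0, h1] <;>
        ring
  · intro p hp
    rw [mem_invariantSubalgebra_quaternion] at hp
    refine mem_of_quaternion_invariant ?_ ?_ ?_ hp.1 hp.2
    · refine ⟨C 2⁻¹ * C α⁻¹ * (X 1 + X 2), ?_⟩
      change brieskornParam α β _ = _
      simp only [map_mul, map_add, hC, brieskornParam_X_one, brieskornParam_X_two]
      linear_combination (2 * C 2⁻¹ * (X 0 ^ 2 * X 1 ^ 2)) * hCα + (X 0 ^ 2 * X 1 ^ 2) * hC2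
    · refine ⟨C 2⁻¹ * C β⁻¹ * (X 1 - X 2), ?_⟩
      change brieskornParam α β _ = _
      simp only [map_mul, map_sub, hC, brieskornParam_X_one, brieskornParam_X_two]
      linear_combination (2 * C 2⁻¹ * (X 0 ^ 4 + X 1 ^ 4)) * hCβ + (X 0 ^ 4 + X 1 ^ 4) * hC2
    · exact ⟨X 0, brieskornParam_X_zero⟩

end Param

theorem Complex.exists_sq_mul_sq_and_pow_four_add (a b : ℂ) :
    ∃ x y : ℂ, x ^ 2 * y ^ 2 = a ∧ x ^ 4 + y ^ 4 = b := by
  obtain ⟨σ, hσ⟩ := IsAlgClosed.exists_pow_nat_eq (b + 2 * a) (n := 2) (by norm_num)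
  obtain ⟨δ, hδ⟩ := IsAlgClosed.exists_pow_nat_eq (b - 2 * a) (n := 2) (by norm_num)
  obtain ⟨x, hx⟩ := IsAlgClosed.exists_pow_nat_eq ((σ + δ) / 2) (n := 2) (by norm_num)
  obtain ⟨y, hy⟩ := IsAlgClosed.exists_pow_nat_eq ((σ - δ) / 2) (n := 2) (by norm_num)
  refine ⟨x, y, ?_, ?_⟩
  · rw [hx, hy]
    linear_combination (hσ - hδ) / 4
  · rw [show x ^ 4 = (x ^ 2) ^ 2 by ring, show y ^ 4 = (y ^ 2) ^ 2 by ring, hx, hy]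
    linear_combination (hσ + hδ) / 2

theorem brieskornParam_rename_injective {α β : ℂ} (hα : α ≠ 0) (hβ : β ≠ 0)
    {q : MvPolynomial (Fin 2) ℂ} (h : brieskornParam α β (rename Fin.succ q) = 0) : q = 0 := by
  refine MvPolynomial.funext fun w => ?_
  obtain ⟨x, y, ha, hb⟩ := Complex.exists_sq_mul_sq_and_pow_four_add
    ((w 0 + w 1) / (2 * α)) ((w 0 - w 1) / (2 * β))
  have h' := congrArg (aeval ![x, y] : MvPolynomial (Fin 2) ℂ →ₐ[ℂ] ℂ) h
  have hcomp : ((aeval ![x, y] : MvPolynomial (Fin 2) ℂ →ₐ[ℂ] ℂ).comp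
      ((brieskornParam α β).comp (rename Fin.succ))) = aeval w := by
    ext i
    fin_cases i
    · simp [brieskornParam_X_one, ha, hb]
      field_simp
      ring
    · simp [brieskornParam_X_two, ha, hb]
      field_simp
      ring
  have h_eval := DFunLike.congr_fun hcomp q
  simp only [AlgHom.comp_apply] at h_eval
  rw [h', map_zero] at h_eval
  rw [map_zero, ← coe_aeval_eq_eval]
  exact h_eval.symm

/-- Modulo `z₁² + z₂³ + z₃³` every polynomial is of degree at most one in `z₁`. -/
theorem exists_linear_mod_brieskorn (q : MvPolynomial (Fin 3) ℂ) :
    ∃ r s : MvPolynomial (Fin 2) ℂ,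
      q - (rename Fin.succ r + X 0 * rename Fin.succ s) ∈
        Ideal.span {(X 0 ^ 2 + X 1 ^ 3 + X 2 ^ 3 : MvPolynomial (Fin 3) ℂ)} := by
  set J := Ideal.span {(X 0 ^ 2 + X 1 ^ 3 + X 2 ^ 3 : MvPolynomial (Fin 3) ℂ)}
  induction q using MvPolynomial.induction_on with
  | C c => exact ⟨C c, 0, by simp⟩
  | add p q hp hq =>
    obtain ⟨r, s, h⟩ := hp
    obtain ⟨r', s', h'⟩ := hq
    refine ⟨r + r', s + s', ?_⟩
    convert J.add_mem h h' using 1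
    simp only [map_add]
    ring
  | mul_X p i hp =>
    obtain ⟨r, s, h⟩ := hp
    cases i using Fin.cases with
    | zero =>
      refine ⟨-((X 0 ^ 3 + X 1 ^ 3) * s), r, ?_⟩
      have hJ : (X 0 ^ 2 + X 1 ^ 3 + X 2 ^ 3 : MvPolynomial (Fin 3) ℂ) ∈ J :=
        Ideal.subset_span rfl
      convert J.add_mem (J.mul_mem_left (X 0) h) (J.mul_mem_left (rename Fin.succ s) hJ) using 1
      simp
      ring
    | succ j =>
      refine ⟨X j * r, X j * s, ?_⟩
      convert J.mul_mem_left (X j.succ) h using 1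
      simp
      ring

theorem ker_brieskornParam {α β : ℂ} (hα : α ^ 3 = 2) (hβ : 6 * α * β ^ 2 = -1) :
    RingHom.ker (brieskornParam α β) =
      Ideal.span {(X 0 ^ 2 + X 1 ^ 3 + X 2 ^ 3 : MvPolynomial (Fin 3) ℂ)} := by
  have hα0 : α ≠ 0 := by rintro rfl; norm_num at hα
  have hβ0 : β ≠ 0 := by rintro rfl; norm_num at hβ
  have hle : Ideal.span {(X 0 ^ 2 + X 1 ^ 3 + X 2 ^ 3 : MvPolynomial (Fin 3) ℂ)} ≤
      RingHom.ker (brieskornParam α β) := by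
    rw [Ideal.span_singleton_le_iff_mem, RingHom.mem_ker]
    exact brieskornParam_equation hα hβ
  refine le_antisymm (fun q hq => ?_) hle
  obtain ⟨r, s, h⟩ := exists_linear_mod_brieskorn q
  have h₀ := hle h
  rw [RingHom.mem_ker] at hq h₀
  rw [map_sub, hq, zero_sub, neg_eq_zero, map_add, map_mul] at h₀
  -- exchanging `x` and `y` fixes `z₂` and `z₃` and negates `z₁`
  let σ : MvPolynomial (Fin 2) ℂ →ₐ[ℂ] MvPolynomial (Fin 2) ℂ := aeval ![X 1, X 0]
  have hσ (t : MvPolynomial (Fin 2) ℂ) : σ (brieskornParam α β (rename Fin.succ t)) =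
      brieskornParam α β (rename Fin.succ t) := by
    have hσC (c : ℂ) : σ (C c) = C c := σ.commutes c
    suffices h' : σ.comp ((brieskornParam α β).comp (rename Fin.succ)) =
        (brieskornParam α β).comp (rename Fin.succ) from DFunLike.congr_fun h' t
    ext1 i
    have h0 : σ (X 0) = X 1 := by simp [σ]
    have h1 : σ (X 1) = X 0 := by simp [σ]
    fin_cases i
    · simp [brieskornParam_X_one, hσC, h0, h1]
      ring
    · simp [brieskornParam_X_two, hσC, h0, h1]
      ring
  have hσ0 : σ (brieskornParam α β (X 0)) = -brieskornParam α β (X 0) := by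
    simp [brieskornParam_X_zero, σ]
    ring
  have h₁ := congrArg σ h₀
  rw [map_add, map_mul, hσ, hσ, hσ0, map_zero] at h₁
  have hr : r = 0 := by
    refine brieskornParam_rename_injective hα0 hβ0 ?_
    refine (mul_eq_zero.mp (?_ : (2 : MvPolynomial (Fin 2) ℂ) * _ = 0)).resolve_left two_ne_zero
    linear_combination h₀ + h₁
  have hs : s = 0 := by
    refine brieskornParam_rename_injective hα0 hβ0 ?_
    rw [hr, map_zero, map_zero, zero_add] at h₀
    refine (mul_eq_zero.mp h₀).resolve_left fun hX => ?_
    have h2 := congrArg (eval ![2, 1]) hX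
    simp [brieskornParam_X_zero] at h2
    norm_num at h2
  simpa [hr, hs] using h

/-- Let `Q₈ ⊂ GL₂(ℂ)` be the quaternion group of order 8 (the binary dihedral group
`Δ'(2,2,2)`) generated by `[[i,0],[0,−i]]` and `[[0,1],[−1,0]]`, acting on `ℂ[x,y]` by linear
substitution.  Then the invariant subalgebra `ℂ[x,y]^{Q₈}` is isomorphic as a ℂ-algebra to
`ℂ[z₁,z₂,z₃]/(z₁² + z₂³ + z₃³)`, the coordinate ring of the Brieskorn variety `V(2,3,3)`.
Hence `V(2,3,3) ≅ ℂ²/Δ'(2,2,2)`. -/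
theorem brieskorn_V233_iso_C2_mod_Q8
    (Q₈ : Subgroup (Matrix (Fin 2) (Fin 2) ℂ)ˣ)
    (hQ₈ : Q₈ = Subgroup.closure
      {u : (Matrix (Fin 2) (Fin 2) ℂ)ˣ | (u : Matrix (Fin 2) (Fin 2) ℂ) = !![Complex.I, 0; 0, -Complex.I] ∨
           (u : Matrix (Fin 2) (Fin 2) ℂ) = !![0, 1; -1, 0]}) :
    Nonempty
      (invariantSubalgebra Q₈ ≃ₐ[ℂ]
        (MvPolynomial (Fin 3) ℂ ⧸
          Ideal.span {(X 0 ^ 2 + X 1 ^ 3 + X 2 ^ 3 : MvPolynomial (Fin 3) ℂ)})) := by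
  subst hQ₈
  obtain ⟨α, hα⟩ := IsAlgClosed.exists_pow_nat_eq (2 : ℂ) (n := 3) (by norm_num)
  have hα0 : α ≠ 0 := by rintro rfl; norm_num at hα
  obtain ⟨β, hβ'⟩ := IsAlgClosed.exists_pow_nat_eq (-1 / (6 * α)) (n := 2) (by norm_num)
  have hβ : 6 * α * β ^ 2 = -1 := by rw [hβ']; field_simp
  have hβ0 : β ≠ 0 := by rintro rfl; norm_num at hβ
  rw [← range_brieskornParam hα0 hβ0, ← ker_brieskornParam hα hβ]
  exact ⟨(Ideal.quotientKerEquivRange (brieskornParam α β)).symm⟩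
end

section
/- Let n ≥ 3, let p₁, …, pₙ ≥ 2 be integers, and let (a_{ji}) be an (n−2)×n complex matrix all of whose maximal minors are nonzero (i.e., every (n−2)×(n−2) submatrix obtained by selecting n−2 of the n columns has nonzero determinant). Define f_j(z₁,…,zₙ) = Σ_{i=1}^{n} a_{ji} z_i^{p_i} for j = 1, …, n−2. Then for every z ∈ ℂⁿ with z ≠ 0 and f_j(z) = 0 for all j, the Jacobian matrix (∂f_j/∂z_i)(z) = (a_{ji} p_i z_i^{p_i−1}) has rank n−2. Hence the Brieskorn complete intersection {f₁ = ⋯ = f_{n−2} = 0} has an isolated singular point at the origin. -/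
open Matrix

/-- A vector killed by `a` and supported in the range of an injective choice of columns with
nonzero minor vanishes. -/
lemma eq_zero_of_mulVec_eq_zero_of_support_subset {m ι K : Type*} [Fintype m] [DecidableEq m]
    [Fintype ι] [Field K] (a : Matrix m ι K) (c : m → ι) (hc : Function.Injective c)
    (hdet : (a.submatrix id c).det ≠ 0) (w : ι → K) (hw : a *ᵥ w = 0)
    (hsupp : ∀ i, w i ≠ 0 → i ∈ Set.range c) : w = 0 := by
  have h : a.submatrix id c *ᵥ (w ∘ c) = 0 := by
    rw [← hw]
    ext j
    simp only [mulVec, dotProduct, submatrix_apply, id, Function.comp]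
    refine Fintype.sum_of_injective c hc _ _ (fun i hi => ?_) fun _ => rfl
    rw [not_not.mp (mt (hsupp i) hi), mul_zero]
  have h0 := eq_zero_of_mulVec_eq_zero hdet h
  ext i
  by_contra hi
  obtain ⟨k, rfl⟩ := hsupp i hi
  exact hi (congrFun h0 k)

/-- Scaling columns preserves full row rank if the columns of some nonzero maximal minor are scaled
by nonzero factors. -/
lemma rank_of_mul_eq_card {m ι K : Type*} [Fintype m] [DecidableEq m]
    [Fintype ι] [Field K] (a : Matrix m ι K) (c : m → ι)
    (hdet : (a.submatrix id c).det ≠ 0) (d : ι → K) (hd : ∀ k, d (c k) ≠ 0) :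
    (Matrix.of fun j i => a j i * d i).rank = Fintype.card m := by
  refine LinearIndependent.rank_matrix (vecMul_injective_iff.mp ?_)
  rw [← coe_vecMulLinear, ← LinearMap.ker_eq_bot, LinearMap.ker_eq_bot']
  intro v hv
  refine eq_zero_of_vecMul_eq_zero hdet ?_
  ext k
  have h := congrFun hv (c k)
  simp only [vecMulLinear_apply, vecMul, dotProduct, of_apply, ← mul_assoc, ← Finset.sum_mul,
    Pi.zero_apply] at h
  exact (mul_eq_zero.mp h).resolve_right (hd k)

/-- Hamm's condition.  Let `n ≥ 3`, let `p₁,…,pₙ ≥ 2` be integers, and let `(a_{ji})` be an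
`(n−2)×n` complex matrix all of whose maximal minors are nonzero.  Define
`f_j(z) = Σ_i a_{ji} z_i^{p_i}`.  Then at every nonzero common zero `z` of the `f_j`, the
Jacobian matrix `(a_{ji} p_i z_i^{p_i−1})` has rank `n − 2`; hence the Brieskorn complete
intersection `{f₁ = ⋯ = f_{n−2} = 0}` has an isolated singular point at the origin. -/
theorem brieskorn_complete_intersection_isolated_singularity
    (n : ℕ) (hn : 3 ≤ n) (p : Fin n → ℕ) (hp : ∀ i, 2 ≤ p i)
    (a : Matrix (Fin (n - 2)) (Fin n) ℂ)
    (ha : ∀ c : Fin (n - 2) → Fin n, Function.Injective c → (a.submatrix id c).det ≠ 0)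
    (z : Fin n → ℂ) (hz : z ≠ 0)
    (hzero : ∀ j, ∑ i, a j i * z i ^ p i = 0) :
    (Matrix.of fun j i => a j i * (p i : ℂ) * z i ^ (p i - 1)).rank = n - 2 := by
  classical
  have hcols : ∀ t : Finset (Fin n), t.card = n - 2 →
      ∃ c : Fin (n - 2) → Fin n, Function.Injective c ∧ Set.range c = t := fun t ht =>
    ⟨t.orderEmbOfFin ht, (t.orderEmbOfFin ht).injective, t.range_orderEmbOfFin ht⟩
  set S : Finset (Fin n) := {i | z i ≠ 0} with hS
  rcases le_total S.card (n - 2) with hle | hle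
  · obtain ⟨t, hSt, ht⟩ := Finset.exists_superset_card_eq hle (by simp)
    obtain ⟨c, hc, hct⟩ := hcols t ht
    refine absurd (funext fun i => ?_) hz
    have hp0 (i : Fin n) : p i ≠ 0 := by have := hp i; omega
    have h0 := eq_zero_of_mulVec_eq_zero_of_support_subset a c hc (ha c hc)
      (fun i => z i ^ p i) (funext hzero) fun i hi => by
        rw [hct]
        exact hSt (by simpa [hS, hp0 i] using hi)
    exact (pow_eq_zero_iff (hp0 i)).mp (congrFun h0 i)
  · obtain ⟨t, htS, ht⟩ := Finset.exists_subset_card_eq hle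
    obtain ⟨c, hc, hct⟩ := hcols t ht
    have hrank := rank_of_mul_eq_card a c (ha c hc) (fun i => (p i : ℂ) * z i ^ (p i - 1))
      fun k => by
        have hk : c k ∈ S := htS (by simpa [hct] using Set.mem_range_self (f := c) k)
        have hpk := hp (c k)
        exact mul_ne_zero (Nat.cast_ne_zero.mpr (by omega))
          (pow_ne_zero _ (by simpa [hS] using hk))
    simpa only [mul_assoc, Fintype.card_fin] using hrank
end

section
/- Let α and β be integers with 0 ≤ α ≤ 4 and 0 ≤ β ≤ 4, and consider the polynomials f₁ = z₁² + z₂² + z₃^α z₄^{4−α} and f₂ = z₃² + z₄² + z₁^β z₂^{4−β} in ℂ[z₁,z₂,z₃,z₄]. Then the system f₁ = f₂ = 0 defines an isolated complete intersection surface singularity at the origin: for every z ∈ ℂ⁴ with z ≠ 0 and f₁(z) = f₂(z) = 0, the 2×4 Jacobian matrix (∂f_j/∂z_i)(z) has rank 2. -/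
open Matrix

theorem natCast_mul_pow_pred_mul_self {R : Type*} [CommSemiring R] (k : ℕ) (x : R) :
    (k : R) * x ^ (k - 1) * x = k * x ^ k := by
  cases k with
  | zero => simp
  | succ k => simp [pow_succ, mul_assoc]

theorem eq_zero_and_eq_zero_of_sq_add_sq_of_pow_mul_pow {R : Type*} [CommRing R] [IsDomain R]
    {x y : R} {k l : ℕ} (hs : x ^ 2 + y ^ 2 = 0) (hm : x ^ k * y ^ l = 0) :
    x = 0 ∧ y = 0 := by
  rcases mul_eq_zero.mp hm with h | h
  · obtain rfl := eq_zero_of_pow_eq_zero h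
    simpa using hs
  · obtain rfl := eq_zero_of_pow_eq_zero h
    simpa using hs

/-- The system of equations in splice diagram form
`z₁² + z₂² + z₃^α z₄^{4−α} = 0`, `z₃² + z₄² + z₁^β z₂^{4−β} = 0` (with `0 ≤ α, β ≤ 4`)
defines an isolated complete intersection surface singularity at the origin: at every nonzero
common zero the 2×4 Jacobian matrix has rank 2. -/
theorem splice_diagram_equations_isolated_singularity
    (α β : ℕ) (hα : α ≤ 4) (hβ : β ≤ 4)
    (z₁ z₂ z₃ z₄ : ℂ) (hz : ¬(z₁ = 0 ∧ z₂ = 0 ∧ z₃ = 0 ∧ z₄ = 0))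
    (h1 : z₁ ^ 2 + z₂ ^ 2 + z₃ ^ α * z₄ ^ (4 - α) = 0)
    (h2 : z₃ ^ 2 + z₄ ^ 2 + z₁ ^ β * z₂ ^ (4 - β) = 0) :
    (!![2 * z₁, 2 * z₂, (α : ℂ) * z₃ ^ (α - 1) * z₄ ^ (4 - α),
          ((4 - α : ℕ) : ℂ) * z₃ ^ α * z₄ ^ (4 - α - 1);
        (β : ℂ) * z₁ ^ (β - 1) * z₂ ^ (4 - β),
          ((4 - β : ℕ) : ℂ) * z₁ ^ β * z₂ ^ (4 - β - 1), 2 * z₃, 2 * z₄]).rank = 2 := by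
  have hcα : ((4 - α : ℕ) : ℂ) = 4 - α := by push_cast [hα]; ring
  have hcβ : ((4 - β : ℕ) : ℂ) = 4 - β := by push_cast [hβ]; ring
  have e₁ := natCast_mul_pow_pred_mul_self β z₁
  have e₂ := natCast_mul_pow_pred_mul_self (4 - β) z₂
  have e₃ := natCast_mul_pow_pred_mul_self α z₃
  have e₄ := natCast_mul_pow_pred_mul_self (4 - α) z₄
  refine (LinearIndependent.rank_matrix ?_).trans (Fintype.card_fin 2)
  refine LinearIndependent.pair_iff.mpr ?_
  intro s t hst
  have c₁ := congrFun hst 0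
  have c₂ := congrFun hst 1
  have c₃ := congrFun hst 2
  have c₄ := congrFun hst 3
  simp [-Nat.cast_sub, -mul_eq_zero] at c₁ c₂ c₃ c₄
  rw [hcα] at c₄ e₄
  rw [hcβ] at c₂ e₂
  -- The two partial Euler fields kill the relation and decouple its coefficients.
  have E₁ : s * (z₁ ^ 2 + z₂ ^ 2) + 2 * t * (z₁ ^ β * z₂ ^ (4 - β)) = 0 := by
    linear_combination (1 / 2) * (z₁ * c₁ + z₂ * c₂ - t * z₂ ^ (4 - β) * e₁ - t * z₁ ^ β * e₂)
  have E₂ : t * (z₃ ^ 2 + z₄ ^ 2) + 2 * s * (z₃ ^ α * z₄ ^ (4 - α)) = 0 := by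
    linear_combination (1 / 2) * (z₃ * c₃ + z₄ * c₄ - s * z₄ ^ (4 - α) * e₃ - s * z₃ ^ α * e₄)
  have hs : s * (z₁ ^ 2 + z₂ ^ 2) = 0 := by
    linear_combination (-1 / 3) * E₁ - (2 / 3) * E₂ + (2 / 3) * t * h2 + (4 / 3) * s * h1
  have ht : t * (z₃ ^ 2 + z₄ ^ 2) = 0 := by
    linear_combination (-1 / 3) * E₂ - (2 / 3) * E₁ + (2 / 3) * s * h1 + (4 / 3) * t * h2
  -- Vanishing of both sums of squares forces the point to be the origin.
  have key : z₁ ^ 2 + z₂ ^ 2 = 0 → z₃ ^ 2 + z₄ ^ 2 = 0 → False := by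
    intro hA hB
    rw [hA, zero_add] at h1
    rw [hB, zero_add] at h2
    obtain ⟨h₁, h₂⟩ := eq_zero_and_eq_zero_of_sq_add_sq_of_pow_mul_pow hA h2
    obtain ⟨h₃, h₄⟩ := eq_zero_and_eq_zero_of_sq_add_sq_of_pow_mul_pow hB h1
    exact hz ⟨h₁, h₂, h₃, h₄⟩
  by_cases hs0 : s = 0
  · refine ⟨hs0, by_contra fun ht0 => ?_⟩
    have hB := (mul_eq_zero.mp ht).resolve_left ht0
    obtain rfl : z₃ = 0 := by simpa [hs0, ht0] using c₃
    obtain rfl : z₄ = 0 := by simpa [hs0, ht0] using c₄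
    refine key ?_ hB
    have hM : (0 : ℂ) ^ α * 0 ^ (4 - α) = 0 := by
      rw [← pow_add, Nat.add_sub_cancel' hα]; norm_num
    rwa [hM, add_zero] at h1
  · exfalso
    have hA := (mul_eq_zero.mp hs).resolve_left hs0
    by_cases ht0 : t = 0
    · obtain rfl : z₁ = 0 := by simpa [hs0, ht0] using c₁
      obtain rfl : z₂ = 0 := by simpa [hs0, ht0] using c₂
      refine key hA ?_
      have hN : (0 : ℂ) ^ β * 0 ^ (4 - β) = 0 := by
        rw [← pow_add, Nat.add_sub_cancel' hβ]; norm_num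
      rwa [hN, add_zero] at h2
    · exact key hA ((mul_eq_zero.mp ht).resolve_left ht0)
end

section
/- Let α and β be integers with 0 ≤ α ≤ 4 and 0 ≤ β ≤ 4, and let G be the subgroup of invertible diagonal 4×4 complex matrices generated by diag(1,−1,i,i), diag(−1,1,i,i), diag(i,i,1,−1), and diag(i,i,−1,1), acting on ℂ[z₁,z₂,z₃,z₄] by z_k ↦ λ_k z_k for a diagonal element diag(λ₁,λ₂,λ₃,λ₄). Then every element of G transforms each of the polynomials f₁ = z₁² + z₂² + z₃^α z₄^{4−α} and f₂ = z₃² + z₄² + z₁^β z₂^{4−β} into a scalar multiple of itself (equivalently, G preserves the variety {f₁ = f₂ = 0}) if and only if both α and β are odd. -/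
open MvPolynomial

/-- The imaginary unit `i` as a unit of `ℂ`. -/
noncomputable def iUnit : ℂˣ := Units.mk0 Complex.I Complex.I_ne_zero

/-- The ℂ-algebra endomorphism of `ℂ[z₁,z₂,z₃,z₄]` induced by the diagonal matrix
`diag(λ₁,λ₂,λ₃,λ₄)`, sending `z_k ↦ λ_k z_k`. -/
noncomputable def diagSubst (g : Fin 4 → ℂˣ) :
    MvPolynomial (Fin 4) ℂ →ₐ[ℂ] MvPolynomial (Fin 4) ℂ :=
  aeval fun k => C (g k : ℂ) * X k

theorem diagSubst_X (g : Fin 4 → ℂˣ) (k : Fin 4) :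
    diagSubst g (X k) = C (g k : ℂ) * X k := by
  simp [diagSubst]

theorem eval_diagSubst (g : Fin 4 → ℂˣ) (p : Fin 4 → ℂ) (f : MvPolynomial (Fin 4) ℂ) :
    eval p (diagSubst g f) = eval (fun k => (g k : ℂ) * p k) f := by
  induction f using MvPolynomial.induction_on with
  | C a => simp [diagSubst]
  | add f₁ f₂ h₁ h₂ => simp [h₁, h₂]
  | mul_X f k h => simp [h, diagSubst_X]

/-- A diagonal substitution scaling `z_i² + z_j² + z_k^a z_l^b` gives all monomials
the same weight. -/
theorem weight_eq_of_diagSubst_eq_smul {g : Fin 4 → ℂˣ} {i j k l : Fin 4} {a b : ℕ}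
    (hij : i ≠ j) (hik : i ≠ k) (hil : i ≠ l) (hjk : j ≠ k) (hjl : j ≠ l) (hab : a + b ≠ 0)
    (h : ∃ c : ℂ, diagSubst g (X i ^ 2 + X j ^ 2 + X k ^ a * X l ^ b)
      = c • (X i ^ 2 + X j ^ 2 + X k ^ a * X l ^ b)) :
    (g k : ℂ) ^ a * (g l : ℂ) ^ b = (g i : ℂ) ^ 2 := by
  obtain ⟨c, hc⟩ := h
  have h₁ := congrArg (eval fun m => if m = i then (1 : ℂ) else 0) hc
  have h₂ := congrArg (eval fun m => if m = k ∨ m = l then (1 : ℂ) else 0) hc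
  have h0 : (0 : ℂ) ^ a * 0 ^ b = 0 := by rw [← pow_add, zero_pow hab]
  rw [eval_diagSubst] at h₁ h₂
  simp [hij.symm, hik.symm, hil.symm, h0, smul_eval] at h₁
  simp [hik, hil, hjk, hjl, smul_eval] at h₂
  rw [h₁, h₂]

theorem exists_diagSubst_eq_smul {g : Fin 4 → ℂˣ} {i j k l : Fin 4} {a b : ℕ}
    (hj : g j ^ 2 = g i ^ 2) (hkl : g k ^ a * g l ^ b = g i ^ 2) :
    ∃ c : ℂ, diagSubst g (X i ^ 2 + X j ^ 2 + X k ^ a * X l ^ b)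
      = c • (X i ^ 2 + X j ^ 2 + X k ^ a * X l ^ b) := by
  have hj' : C (g j : ℂ) ^ 2 = (C (g i : ℂ) ^ 2 : MvPolynomial (Fin 4) ℂ) := by
    rw [← C_pow, ← C_pow]; exact_mod_cast congrArg (fun u : ℂˣ => C (u : ℂ)) hj
  have hkl' : C (g k : ℂ) ^ a * C (g l : ℂ) ^ b =
      (C (g i : ℂ) ^ 2 : MvPolynomial (Fin 4) ℂ) := by
    rw [← C_pow, ← C_pow, ← C_pow, ← C_mul]
    exact_mod_cast congrArg (fun u : ℂˣ => C (u : ℂ)) hkl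
  refine ⟨(g i : ℂ) ^ 2, ?_⟩
  simp only [map_add, map_mul, map_pow, diagSubst_X, smul_eq_C_mul, mul_pow]
  linear_combination (X j ^ 2) * hj' + (X k ^ a * X l ^ b) * hkl'

/-- The diagonal matrices giving all monomials of `z_i² + z_j² + z_k^a z_l^b` the same
weight. -/
def weightSubgroup (i j k l : Fin 4) (a b : ℕ) : Subgroup (Fin 4 → ℂˣ) where
  carrier := {g | g j ^ 2 = g i ^ 2 ∧ g k ^ a * g l ^ b = g i ^ 2}
  one_mem' := by simp
  mul_mem' := by
    rintro g h ⟨hg₁, hg₂⟩ ⟨hh₁, hh₂⟩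
    refine ⟨by simp [mul_pow, hg₁, hh₁], ?_⟩
    simp only [Pi.mul_apply, mul_pow]
    rw [← hg₂, ← hh₂, mul_mul_mul_comm]
  inv_mem' := by
    rintro g ⟨hg₁, hg₂⟩
    refine ⟨by simp [hg₁], ?_⟩
    simp only [Pi.inv_apply, inv_pow]
    rw [← hg₂, mul_inv]

theorem iUnit_sq : iUnit ^ 2 = -1 := by
  ext; simp [iUnit]

theorem iUnit_pow_mul_pow {a : ℕ} (ha : a ≤ 4) : iUnit ^ a * iUnit ^ (4 - a) = 1 := by
  rw [← pow_add, Nat.add_sub_cancel' ha, show 4 = 2 * 2 from rfl, pow_mul, iUnit_sq]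
  simp

/-- Congruence condition for the quotient-cusp example.  Let `0 ≤ α, β ≤ 4` and let `G` be
the subgroup of invertible diagonal 4×4 complex matrices generated by `diag(1,−1,i,i)`,
`diag(−1,1,i,i)`, `diag(i,i,1,−1)`, `diag(i,i,−1,1)`.  Every element of `G` transforms each
of `f₁ = z₁² + z₂² + z₃^α z₄^{4−α}` and `f₂ = z₃² + z₄² + z₁^β z₂^{4−β}` into a scalar
multiple of itself if and only if both `α` and `β` are odd. -/
theorem congruence_condition_iff_odd
    (α β : ℕ) (hα : α ≤ 4) (hβ : β ≤ 4)
    (G : Subgroup (Fin 4 → ℂˣ))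
    (hG : G = Subgroup.closure
      {![1, -1, iUnit, iUnit], ![-1, 1, iUnit, iUnit],
        ![iUnit, iUnit, 1, -1], ![iUnit, iUnit, -1, 1]}) :
    (∀ g ∈ G,
        (∃ c : ℂ, diagSubst g (X 0 ^ 2 + X 1 ^ 2 + X 2 ^ α * X 3 ^ (4 - α))
            = c • (X 0 ^ 2 + X 1 ^ 2 + X 2 ^ α * X 3 ^ (4 - α))) ∧
        (∃ c : ℂ, diagSubst g (X 2 ^ 2 + X 3 ^ 2 + X 0 ^ β * X 1 ^ (4 - β))
            = c • (X 2 ^ 2 + X 3 ^ 2 + X 0 ^ β * X 1 ^ (4 - β)))) ↔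
      (Odd α ∧ Odd β) := by
  subst hG
  constructor
  · intro h
    have h₁ := (h ![iUnit, iUnit, -1, 1] (Subgroup.subset_closure (by simp))).1
    have h₂ := (h ![-1, 1, iUnit, iUnit] (Subgroup.subset_closure (by simp))).2
    replace h₁ := weight_eq_of_diagSubst_eq_smul (by decide) (by decide) (by decide)
      (by decide) (by decide) (by omega) h₁
    replace h₂ := weight_eq_of_diagSubst_eq_smul (by decide) (by decide) (by decide)
      (by decide) (by decide) (by omega) h₂
    simp [iUnit] at h₁ h₂
    exact ⟨(neg_one_pow_eq_neg_one_iff_odd (by norm_num)).1 h₁,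
      (neg_one_pow_eq_neg_one_iff_odd (by norm_num)).1 h₂⟩
  · rintro ⟨oα, oβ⟩ g hg
    have oα' : Odd (4 - α) := Nat.Even.sub_odd hα (by decide) oα
    have oβ' : Odd (4 - β) := Nat.Even.sub_odd hβ (by decide) oβ
    have hle : Subgroup.closure
        {![1, -1, iUnit, iUnit], ![-1, 1, iUnit, iUnit],
          ![iUnit, iUnit, 1, -1], ![iUnit, iUnit, -1, 1]} ≤
        weightSubgroup 0 1 2 3 α (4 - α) ⊓ weightSubgroup 2 3 0 1 β (4 - β) := by
      rw [Subgroup.closure_le]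
      rintro g (rfl | rfl | rfl | rfl) <;>
        simp [weightSubgroup, iUnit_sq, iUnit_pow_mul_pow, hα, hβ, oα.neg_one_pow,
          oβ.neg_one_pow, oα'.neg_one_pow, oβ'.neg_one_pow]
    obtain ⟨⟨h₁, h₂⟩, h₃, h₄⟩ := hle hg
    exact ⟨exists_diagSubst_eq_smul h₁ h₂, exists_diagSubst_eq_smul h₃ h₄⟩
end

section
/- Let α, β ∈ {1, 3} and let V = {z ∈ ℂ⁴ : z₁² + z₂² + z₃^α z₄^{4−α} = 0 and z₃² + z₄² + z₁^β z₂^{4−β} = 0}. Let G be the subgroup of invertible diagonal 4×4 complex matrices generated by diag(1,−1,i,i), diag(−1,1,i,i), diag(i,i,1,−1), and diag(i,i,−1,1). Then G acts freely on V ∖ {0}: for every g ∈ G with g ≠ 1 and every z ∈ V with z ≠ 0, g·z ≠ z. -/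
theorem coord_relations_of_mem_closure {g : Fin 4 → ℂˣ}
    (hg : g ∈ Subgroup.closure ({![1, -1, iUnit, iUnit], ![-1, 1, iUnit, iUnit],
        ![iUnit, iUnit, 1, -1], ![iUnit, iUnit, -1, 1]} : Set (Fin 4 → ℂˣ))) :
    g 1 = g 2 ^ 2 * g 0 ∧ g 3 = g 0 ^ 2 * g 2 := by
  have hi : iUnit ^ 2 = -1 := by
    ext
    simp [iUnit]
  induction hg using Subgroup.closure_induction with
  | mem x hx =>
    simp only [Set.mem_insert_iff, Set.mem_singleton_iff] at hx
    rcases hx with rfl | rfl | rfl | rfl <;> simp [hi]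
  | one => simp
  | mul x y _ _ hx hy =>
    simp only [Pi.mul_apply, hx.1, hx.2, hy.1, hy.2, mul_pow]
    constructor <;> ac_rfl
  | inv x _ hx =>
    simp only [Pi.inv_apply, hx.1, hx.2, mul_inv, inv_pow, and_self]

/-- A nonzero solution of the two equations whose first coordinate vanishes has all its other
coordinates nonzero. -/
theorem ne_zero_of_first_eq_zero {a b c d : ℂ} {p q r s : ℕ}
    (hp : p ≠ 0) (hr : r ≠ 0) (hne : ¬(b = 0 ∧ c = 0 ∧ d = 0)) (ha : a = 0)
    (h₁ : a ^ 2 + b ^ 2 + c ^ p * d ^ q = 0)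
    (h₂ : c ^ 2 + d ^ 2 + a ^ r * b ^ s = 0) : b ≠ 0 ∧ c ≠ 0 ∧ d ≠ 0 := by
  subst ha
  simp only [ne_eq, OfNat.ofNat_ne_zero, not_false_eq_true, zero_pow, zero_add, hr, zero_mul,
    add_zero] at h₁ h₂
  have hcd : c = 0 ↔ d = 0 := by
    constructor <;> rintro rfl <;> simpa using h₂
  have hc : c ≠ 0 := by
    intro hc
    refine hne ⟨?_, hc, hcd.1 hc⟩
    simpa [hc, hp] using h₁
  have hd : d ≠ 0 := mt hcd.2 hc
  refine ⟨?_, hc, hd⟩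
  rintro rfl
  simp [hc, hd] at h₁

/-- Let `α, β ∈ {1,3}` and let `V ⊂ ℂ⁴` be the splice diagram complete intersection
`{z₁² + z₂² + z₃^α z₄^{4−α} = 0, z₃² + z₄² + z₁^β z₂^{4−β} = 0}`.  The group `G` of diagonal
matrices generated by `diag(1,−1,i,i)`, `diag(−1,1,i,i)`, `diag(i,i,1,−1)`, `diag(i,i,−1,1)`
acts freely on `V ∖ {0}`: no nontrivial element of `G` fixes a nonzero point of `V`. -/
theorem discriminant_group_acts_freely
    (α β : ℕ) (hα : α = 1 ∨ α = 3) (hβ : β = 1 ∨ β = 3)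
    (G : Subgroup (Fin 4 → ℂˣ))
    (hG : G = Subgroup.closure
      {![1, -1, iUnit, iUnit], ![-1, 1, iUnit, iUnit],
        ![iUnit, iUnit, 1, -1], ![iUnit, iUnit, -1, 1]}) :
    ∀ g ∈ G, g ≠ 1 → ∀ z : Fin 4 → ℂ, z ≠ 0 →
      z 0 ^ 2 + z 1 ^ 2 + z 2 ^ α * z 3 ^ (4 - α) = 0 →
      z 2 ^ 2 + z 3 ^ 2 + z 0 ^ β * z 1 ^ (4 - β) = 0 →
      (fun k => (g k : ℂ) * z k) ≠ z := by
  intro g hgG hg1 z hz h₁ h₂ hfix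
  subst hG
  obtain ⟨r1, r3⟩ := coord_relations_of_mem_closure hgG
  have key : ∀ k, z k ≠ 0 → g k = 1 := fun k hk =>
    Units.ext (mul_right_cancel₀ hk ((congrFun hfix k).trans (one_mul _).symm))
  have trivial_of : g 0 = 1 → g 2 = 1 → False := by
    intro h0 h2
    apply hg1
    funext k
    fin_cases k <;> simp [r1, r3, h0, h2]
  have hz' : ¬(z 0 = 0 ∧ z 1 = 0 ∧ z 2 = 0 ∧ z 3 = 0) := by
    rintro ⟨h0, h1, h2, h3⟩
    apply hz
    funext k
    fin_cases k <;> assumption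
  by_cases h0 : z 0 = 0
  · obtain ⟨n1, n2, -⟩ := ne_zero_of_first_eq_zero (by omega) (by omega)
      (fun h => hz' ⟨h0, h⟩) h0 h₁ h₂
    have g2 := key 2 n2
    exact trivial_of (by simpa [g2, key 1 n1] using r1.symm) g2
  by_cases h2 : z 2 = 0
  · obtain ⟨n3, n0, -⟩ := ne_zero_of_first_eq_zero (by omega) (by omega)
      (fun h => h0 h.2.1) h2 h₂ h₁
    have g0 := key 0 n0
    exact trivial_of g0 (by simpa [g0, key 3 n3] using r3.symm)
  exact trivial_of (key 0 h0) (key 2 h2)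
end
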